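/- For every n ≥ 1 and t > 0, r_n(t)² + 2(1 − (−1)^n) t + Σ_{j=0}^{n−1} R_j(t) = 2 β_n(t) R_{n−1}(t) + 2 β_n(t) R_n(t). -/

import Mathlib

open MeasureTheory Polynomial

/-- The singularly perturbed Gaussian weight `w(x,t) = exp(-x^2 - t/x^2)` for `x ≠ 0`,
extended by `0` at `x = 0`. -/
noncomputable def w (t x : ℝ) : ℝ := if x = 0 then 0 else Real.exp (-x ^ 2 - t / x ^ 2)

lemma w_zero (t : ℝ) : w t 0 = 0 := if_pos rfl

lemma w_of_ne_zero (t : ℝ) {x : ℝ} (hx : x ≠ 0) : w t x = Real.exp (-x ^ 2 - t / x ^ 2) :=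
  if_neg hx

lemma w_neg (t x : ℝ) : w t (-x) = w t x := by simp [w]

lemma measurable_w (t : ℝ) : Measurable (w t) :=
  Measurable.ite (measurableSet_singleton 0) measurable_const (by fun_prop)

/-- The essential zero of the weight at the origin dominates `x ^ 4`. -/
lemma abs_w_le {t : ℝ} (ht : 0 < t) (x : ℝ) :
    |w t x| ≤ 2 / t ^ 2 * x ^ 4 * Real.exp (-x ^ 2) := by
  rcases eq_or_ne x 0 with rfl | hx
  · simp [w_zero]
  have hu : 0 < t / x ^ 2 := by positivity
  have hexp : (t / x ^ 2) ^ 2 / 2 ≤ Real.exp (t / x ^ 2) := by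
    have := Real.quadratic_le_exp_of_nonneg hu.le
    linarith
  have hinv : Real.exp (-(t / x ^ 2)) ≤ 2 / t ^ 2 * x ^ 4 := by
    rw [Real.exp_neg, inv_le_comm₀ (Real.exp_pos _) (by positivity)]
    refine le_trans (le_of_eq ?_) hexp
    field_simp
  rw [w_of_ne_zero t hx, abs_of_pos (Real.exp_pos _),
    show -x ^ 2 - t / x ^ 2 = -(t / x ^ 2) + -x ^ 2 by ring, Real.exp_add]
  exact mul_le_mul_of_nonneg_right hinv (Real.exp_pos _).le

lemma hasDerivAt_w {t : ℝ} (ht : 0 < t) (x : ℝ) :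
    HasDerivAt (w t) ((2 * t - 2 * x ^ 4) / x ^ 3 * w t x) x := by
  rcases eq_or_ne x 0 with rfl | hx
  · rw [w_zero, mul_zero]
    have hO : w t =O[nhds 0] fun x => ‖x - 0‖ ^ 4 := by
      refine Asymptotics.IsBigO.of_bound (2 / t ^ 2) (Filter.Eventually.of_forall fun x => ?_)
      rw [sub_zero, norm_pow, norm_norm, Real.norm_eq_abs, Real.norm_eq_abs,
        Even.pow_abs (by decide)]
      refine (abs_w_le ht x).trans (mul_le_of_le_one_right (by positivity) ?_)
      rw [Real.exp_le_one_iff]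
      nlinarith [sq_nonneg x]
    have := (hO.hasFDerivAt (𝕜 := ℝ) (by norm_num)).hasDerivAt
    simpa using this
  · have hd : HasDerivAt (fun y : ℝ => Real.exp (-y ^ 2 - t / y ^ 2))
        ((2 * t - 2 * x ^ 4) / x ^ 3 * w t x) x := by
      have h2 : HasDerivAt (fun y : ℝ => y ^ 2) (2 * x) x := by simpa using hasDerivAt_pow 2 x
      have := (h2.neg.sub ((hasDerivAt_const x t).div h2 (pow_ne_zero 2 hx))).exp
      refine this.congr_deriv ?_
      simp only [Pi.neg_apply, Pi.sub_apply, Pi.div_apply, w_of_ne_zero t hx]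
      field_simp
      ring
    refine hd.congr_of_eventuallyEq ?_
    filter_upwards [isOpen_ne.mem_nhds hx] with y hy using w_of_ne_zero t hy

lemma integrable_eval_div_cube_mul_w {t : ℝ} (ht : 0 < t) (p : ℝ[X]) :
    Integrable fun x => p.eval x / x ^ 3 * w t x := by
  induction p using Polynomial.induction_on' with
  | add p q hp hq =>
    simp only [eval_add, add_div, add_mul]
    exact hp.add hq
  | monomial n a =>
    have hg : Integrable fun x : ℝ => x ^ (n + 1) * Real.exp (-x ^ 2) := by
      have := integrable_rpow_mul_exp_neg_mul_sq (b := 1) one_pos (s := (n + 1 : ℕ))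
        (by push_cast; linarith [Nat.cast_nonneg (α := ℝ) n])
      simpa only [Real.rpow_natCast, neg_mul, one_mul] using this
    refine (hg.const_mul (|a| * (2 / t ^ 2))).mono ?_ (Filter.Eventually.of_forall fun x => ?_)
    · have := measurable_w t
      exact (Measurable.mul (by fun_prop) this).aestronglyMeasurable
    · rcases eq_or_ne x 0 with rfl | hx
      · simp [w_zero]
      have hx' : 0 < |x| := abs_pos.2 hx
      simp only [eval_monomial, Real.norm_eq_abs, abs_mul, abs_div, abs_pow, abs_abs, Real.abs_exp]
      calc |a| * |x| ^ n / |x| ^ 3 * |w t x|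
          ≤ |a| * |x| ^ n / |x| ^ 3 * (2 / t ^ 2 * x ^ 4 * Real.exp (-x ^ 2)) := by
            gcongr
            exact abs_w_le ht x
        _ = _ := by
            rw [← Even.pow_abs (show Even 4 by decide) x, abs_of_pos ht, abs_two]
            field_simp
            ring

/-- The linear functional `p ↦ ∫ p(x) x⁻³ w(x,t) dx`. -/
noncomputable def cubeMoment {t : ℝ} (ht : 0 < t) : ℝ[X] →ₗ[ℝ] ℝ where
  toFun p := ∫ x, p.eval x / x ^ 3 * w t x
  map_add' p q := by
    simp only [eval_add, add_div, add_mul]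
    exact integral_add (integrable_eval_div_cube_mul_w ht p) (integrable_eval_div_cube_mul_w ht q)
  map_smul' a p := by
    simp only [eval_smul, smul_eq_mul, mul_div_assoc, mul_assoc, RingHom.id_apply]
    exact integral_const_mul _ _

lemma cubeMoment_apply {t : ℝ} (ht : 0 < t) (p : ℝ[X]) :
    cubeMoment ht p = ∫ x, p.eval x / x ^ 3 * w t x := rfl

lemma cubeMoment_cube_mul {t : ℝ} (ht : 0 < t) (p : ℝ[X]) :
    cubeMoment ht (X ^ 3 * p) = ∫ x, p.eval x * w t x := by
  rw [cubeMoment_apply]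
  congr 1 with x
  rcases eq_or_ne x 0 with rfl | hx
  · simp [w_zero]
  · simp only [eval_mul, eval_pow, eval_X]
    field_simp

lemma cubeMoment_X_mul {t : ℝ} (ht : 0 < t) (p : ℝ[X]) :
    cubeMoment ht (X * p) = ∫ x, p.eval x / x ^ 2 * w t x := by
  rw [cubeMoment_apply]
  congr 1 with x
  rcases eq_or_ne x 0 with rfl | hx
  · simp [w_zero]
  · simp only [eval_mul, eval_X]
    field_simp

lemma cubeMoment_comp_neg_X {t : ℝ} (ht : 0 < t) (p : ℝ[X]) :
    cubeMoment ht (p.comp (-X)) = -cubeMoment ht p := by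
  rw [cubeMoment_apply, cubeMoment_apply, ← integral_neg,
    ← integral_neg_eq_self (fun x => -(p.eval x / x ^ 3 * w t x))]
  congr 1 with x
  simp only [eval_comp, eval_neg, eval_X, w_neg, Odd.neg_pow (show Odd 3 by decide), div_neg]
  ring

lemma cubeMoment_derivative {t : ℝ} (ht : 0 < t) (p : ℝ[X]) :
    cubeMoment ht (X ^ 3 * derivative p + p * (C (2 * t) - C 2 * X ^ 4)) = 0 := by
  have hint : Integrable fun x => p.eval x * w t x := by
    refine (integrable_eval_div_cube_mul_w ht (X ^ 3 * p)).congr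
      (Filter.Eventually.of_forall fun x => ?_)
    rcases eq_or_ne x 0 with rfl | hx
    · simp [w_zero]
    · simp only [eval_mul, eval_pow, eval_X]
      field_simp
  refine integral_eq_zero_of_hasDerivAt_of_integrable (fun x => ?_)
    (integrable_eval_div_cube_mul_w ht _) hint
  refine ((p.hasDerivAt x).mul (hasDerivAt_w ht x)).congr_deriv ?_
  rcases eq_or_ne x 0 with rfl | hx
  · simp [w_zero]
  · simp only [eval_mul, eval_pow, eval_X, eval_add, eval_sub, eval_C]
    field_simp

/-- `P` is the family of monic orthogonal polynomials of the moment functional `M`, and `h n` is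
the squared norm of `P n`. -/
structure IsMonicOrthogonal (M : ℝ[X] →ₗ[ℝ] ℝ) (P : ℕ → ℝ[X]) (h : ℕ → ℝ) : Prop where
  monic : ∀ n, (P n).Monic
  natDegree_eq : ∀ n, (P n).natDegree = n
  orth : ∀ m n, m ≠ n → M (P m * P n) = 0
  norm : ∀ n, M (P n * P n) = h n
  pos : ∀ n, 0 < h n

namespace IsMonicOrthogonal

variable {M : ℝ[X] →ₗ[ℝ] ℝ} {P : ℕ → ℝ[X]} {h : ℕ → ℝ}

lemma coeff_self (H : IsMonicOrthogonal M P h) (n : ℕ) : (P n).coeff n = 1 := by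
  simpa [H.natDegree_eq] using (H.monic n).coeff_natDegree

lemma coeff_of_lt (H : IsMonicOrthogonal M P h) {m n : ℕ} (hmn : m < n) : (P m).coeff n = 0 :=
  coeff_eq_zero_of_natDegree_lt (by rwa [H.natDegree_eq])

lemma zero_eq_one (H : IsMonicOrthogonal M P h) : P 0 = 1 :=
  (H.monic 0).natDegree_eq_zero.1 (H.natDegree_eq 0)

lemma degree_sub_coeff_mul_lt (H : IsMonicOrthogonal M P h) {d : ℕ} {q : ℝ[X]}
    (hq : q.natDegree ≤ d) : (q - C (q.coeff d) * P d).degree < d := by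
  rw [degree_lt_iff_coeff_zero]
  intro m hm
  rcases hm.eq_or_lt with rfl | hm
  · simp [H.coeff_self]
  · simp [H.coeff_of_lt hm, coeff_eq_zero_of_natDegree_lt (hq.trans_lt hm)]

lemma apply_mul_eq_zero (H : IsMonicOrthogonal M P h) {d n : ℕ} (hdn : d ≤ n) {q : ℝ[X]}
    (hq : q.degree < d) : M (q * P n) = 0 := by
  induction d generalizing q with
  | zero =>
    have : q = 0 := by simpa [Nat.WithBot.lt_zero_iff] using hq
    simp [this]
  | succ d ih =>
    have hq' : q.natDegree ≤ d := natDegree_le_of_degree_le (Order.le_of_lt_succ hq)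
    have := ih (by omega) (H.degree_sub_coeff_mul_lt hq')
    rwa [sub_mul, mul_assoc, ← smul_eq_C_mul, map_sub, map_smul, H.orth d n (by omega), smul_zero,
      sub_zero] at this

lemma apply_mul_eq_coeff_mul (H : IsMonicOrthogonal M P h) {n : ℕ} {q : ℝ[X]}
    (hq : q.natDegree ≤ n) : M (q * P n) = q.coeff n * h n := by
  have := H.apply_mul_eq_zero le_rfl (H.degree_sub_coeff_mul_lt hq)
  rw [sub_mul, mul_assoc, ← smul_eq_C_mul, map_sub, map_smul, H.norm, smul_eq_mul] at this
  linarith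

lemma eq_zero_of_forall_lt (H : IsMonicOrthogonal M P h) {n : ℕ} {q : ℝ[X]}
    (hq : q.natDegree ≤ n) (hcoeff : q.coeff n = 0) (horth : ∀ j < n, M (q * P j) = 0) :
    q = 0 := by
  rw [← leadingCoeff_eq_zero, leadingCoeff]
  rcases hq.eq_or_lt with hq | hq
  · rwa [hq]
  · have := horth _ hq
    rw [H.apply_mul_eq_coeff_mul le_rfl] at this
    exact (mul_eq_zero.1 this).resolve_right (H.pos _).ne'

lemma comp_neg_X (H : IsMonicOrthogonal M P h) (heven : ∀ p, M (p.comp (-X)) = M p) (n : ℕ) :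
    (P n).comp (-X) = C ((-1) ^ n) * P n := by
  have hcomp : ∀ m, ((P m).comp (-X)).natDegree = m := fun m => by
    simp [natDegree_comp, H.natDegree_eq]
  refine sub_eq_zero.1 (H.eq_zero_of_forall_lt (n := n) ?_ ?_ fun j hj => ?_)
  · refine (natDegree_sub_le _ _).trans (max_le (hcomp n).le ?_)
    exact (natDegree_C_mul_le _ _).trans (H.natDegree_eq n).le
  · have := coeff_comp_degree_mul_degree (p := P n) (q := -X) (by simp)
    simp only [H.natDegree_eq, natDegree_neg, natDegree_X, mul_one, leadingCoeff_neg,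
      leadingCoeff_X, (H.monic n).leadingCoeff, one_mul] at this
    rw [coeff_sub, this, coeff_C_mul, H.coeff_self, mul_one, sub_self]
  · have h1 : M ((P n).comp (-X) * P j) = 0 := by
      rw [← heven, mul_comp, comp_assoc, neg_comp, X_comp, neg_neg, comp_X, mul_comm,
        H.apply_mul_eq_coeff_mul ((hcomp j).trans_le hj.le),
        coeff_eq_zero_of_natDegree_lt ((hcomp j).trans_lt hj), zero_mul]
    rw [sub_mul, mul_assoc, ← smul_eq_C_mul, map_sub, map_smul, h1, H.orth n j hj.ne', smul_zero,
      sub_zero]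

lemma apply_X_mul_mul_self (H : IsMonicOrthogonal M P h) (heven : ∀ p, M (p.comp (-X)) = M p)
    (n : ℕ) : M (X * P n * P n) = 0 := by
  have := heven (X * P n * P n)
  rw [mul_comp, mul_comp, X_comp, H.comp_neg_X heven] at this
  have hsq : (C ((-1) ^ n) * C ((-1) ^ n) : ℝ[X]) = 1 := by
    rw [← C_mul, ← mul_pow]
    simp
  rw [show -X * (C ((-1) ^ n) * P n) * (C ((-1) ^ n) * P n)
    = -(C ((-1) ^ n) * C ((-1) ^ n) * (X * P n * P n)) by ring, hsq, one_mul, map_neg] at this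
  linarith

lemma one_eq_X (H : IsMonicOrthogonal M P h) (heven : ∀ p, M (p.comp (-X)) = M p) :
    P 1 = X := by
  refine sub_eq_zero.1 (H.eq_zero_of_forall_lt (n := 1) ?_ ?_ fun j hj => ?_)
  · exact (natDegree_sub_le _ _).trans (max_le (H.natDegree_eq 1).le natDegree_X_le)
  · simp [H.coeff_self]
  · obtain rfl : j = 0 := by omega
    have := H.apply_X_mul_mul_self heven 0
    rw [sub_mul, map_sub, H.orth 1 0 one_ne_zero]
    simpa [H.zero_eq_one] using this

/-- The three-term recurrence of a symmetric functional. -/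
lemma X_mul (H : IsMonicOrthogonal M P h) (heven : ∀ p, M (p.comp (-X)) = M p) (n : ℕ) :
    X * P (n + 1) = P (n + 2) + C (h (n + 1) / h n) * P n := by
  have hX : ∀ m, (X * P m).natDegree = m + 1 := fun m => by
    rw [natDegree_X_mul (H.monic m).ne_zero, H.natDegree_eq]
  refine sub_eq_zero.1 (H.eq_zero_of_forall_lt (n := n + 2) ?_ ?_ fun j hj => ?_)
  · refine (natDegree_sub_le _ _).trans (max_le (hX _).le ?_)
    refine (natDegree_add_le _ _).trans (max_le (H.natDegree_eq _).le ?_)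
    exact (natDegree_C_mul_le _ _).trans ((H.natDegree_eq n).trans_le (by omega))
  · simp [coeff_X_mul, H.coeff_self, H.coeff_of_lt (show n < n + 2 by omega)]
  · rw [sub_mul, add_mul, mul_assoc (C _), ← smul_eq_C_mul, map_sub, map_add, map_smul,
      H.orth (n + 2) j hj.ne', zero_add, smul_eq_mul]
    rcases (Nat.lt_succ_iff.1 hj).eq_or_lt with rfl | hj
    · rw [H.apply_X_mul_mul_self heven, H.orth n _ (by omega), mul_zero, sub_zero]
    · rw [show X * P (n + 1) * P j = X * P j * P (n + 1) by ring,
        H.apply_mul_eq_coeff_mul ((hX j).trans_le hj), coeff_X_mul]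
      rcases (Nat.lt_succ_iff.1 hj).eq_or_lt with rfl | hj
      · rw [H.coeff_self, H.norm, div_mul_cancel₀ _ (H.pos j).ne']
        ring
      · rw [H.coeff_of_lt hj, H.orth n j hj.ne']
        ring

lemma X_dvd_of_odd (H : IsMonicOrthogonal M P h) (heven : ∀ p, M (p.comp (-X)) = M p) {n : ℕ}
    (hn : Odd n) : X ∣ P n := by
  have := congrArg (eval 0) (H.comp_neg_X heven n)
  rw [X_dvd_iff, coeff_zero_eq_eval_zero]
  simp only [eval_comp, eval_neg, eval_X, neg_zero, eval_mul, eval_C, hn.neg_one_pow] at this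
  linarith

/-- Consecutive orthogonal polynomials satisfy `M(P (n + 1) P n / X) = h n` or `0`, according to
the parity of `n`; the functional `N` gives a meaning to `M(· / X)`. -/
lemma apply_consecutive (H : IsMonicOrthogonal M P h) (heven : ∀ p, M (p.comp (-X)) = M p)
    {N : ℝ[X] →ₗ[ℝ] ℝ} (hN : ∀ p, N (X * p) = M p) (n : ℕ) :
    N (P (n + 1) * P n) = (1 + (-1) ^ n) / 2 * h n := by
  rcases n.even_or_odd with hn | hn
  · obtain ⟨q, hq⟩ := H.X_dvd_of_odd heven hn.add_one
    have hdeg : q.natDegree = n := by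
      have := H.natDegree_eq (n + 1)
      have hq0 : q ≠ 0 := by
        rintro rfl
        exact (H.monic (n + 1)).ne_zero (by simpa using hq)
      rw [hq, natDegree_X_mul hq0] at this
      omega
    have hcoeff : q.coeff n = 1 := by rw [← coeff_X_mul, ← hq, H.coeff_self]
    rw [hq, mul_assoc, hN, H.apply_mul_eq_coeff_mul hdeg.le, hcoeff, hn.neg_one_pow]
    ring
  · obtain ⟨q, hq⟩ := H.X_dvd_of_odd heven hn
    have hdeg : q.natDegree < n + 1 := by
      have := H.natDegree_eq n
      have hq0 : q ≠ 0 := by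
        rintro rfl
        exact (H.monic n).ne_zero (by simpa using hq)
      rw [hq, natDegree_X_mul hq0] at this
      omega
    rw [hq, mul_comm, mul_assoc, hN, H.apply_mul_eq_coeff_mul hdeg.le,
      coeff_eq_zero_of_natDegree_lt hdeg, hn.neg_one_pow]
    ring

lemma apply_derivative_succ_mul (H : IsMonicOrthogonal M P h) (n : ℕ) :
    M (derivative (P (n + 1)) * P n) = (n + 1) * h n := by
  have hd : (derivative (P (n + 1))).natDegree ≤ n :=
    (natDegree_derivative_le _).trans (by rw [H.natDegree_eq]; omega)
  rw [H.apply_mul_eq_coeff_mul hd, coeff_derivative, H.coeff_self, one_mul]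

lemma apply_derivative_mul_succ (H : IsMonicOrthogonal M P h) (n : ℕ) :
    M (derivative (P n) * P (n + 1)) = 0 := by
  have hd : (derivative (P n)).natDegree < n + 1 :=
    (natDegree_derivative_le _).trans_lt (by rw [H.natDegree_eq]; omega)
  rw [H.apply_mul_eq_coeff_mul hd.le, coeff_eq_zero_of_natDegree_lt hd, zero_mul]

end IsMonicOrthogonal

section Ladder

variable {t : ℝ} {L M : ℝ[X] →ₗ[ℝ] ℝ} {P : ℕ → ℝ[X]} {h : ℕ → ℝ}

lemma two_mul_recurrence_coeff (H : IsMonicOrthogonal M P h) (hM : ∀ p, M p = L (X ^ 3 * p))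
    (hL : ∀ p, L (X ^ 3 * derivative p + p * (C (2 * t) - C 2 * X ^ 4)) = 0) (n : ℕ) :
    2 * (h (n + 1) / h n) = n + 1 + 2 * t / h n * L (P (n + 1) * P n) := by
  have hX : (X * P n).natDegree = n + 1 := by
    rw [natDegree_X_mul (H.monic n).ne_zero, H.natDegree_eq]
  have hXP : M (X * P n * P (n + 1)) = h (n + 1) := by
    rw [H.apply_mul_eq_coeff_mul hX.le, coeff_X_mul, H.coeff_self, one_mul]
  have key := hL (P (n + 1) * P n)
  rw [derivative_mul, show X ^ 3 * (derivative (P (n + 1)) * P n + P (n + 1) * derivative (P n))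
      + P (n + 1) * P n * (C (2 * t) - C 2 * X ^ 4)
      = X ^ 3 * (derivative (P (n + 1)) * P n) + X ^ 3 * (derivative (P n) * P (n + 1))
        + C (2 * t) * (P (n + 1) * P n) - C 2 * (X ^ 3 * (X * P n * P (n + 1))) by ring,
    ← smul_eq_C_mul, ← smul_eq_C_mul] at key
  simp only [map_sub, map_add, map_smul, ← hM, H.apply_derivative_succ_mul,
    H.apply_derivative_mul_succ, hXP, smul_eq_mul] at key
  have := (H.pos n).ne'
  field_simp
  linarith

lemma apply_consecutive_add (H : IsMonicOrthogonal M P h)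
    (heven : ∀ p, M (p.comp (-X)) = M p) (n : ℕ) :
    2 * t / h (n + 1) * L (P (n + 2) * P (n + 1)) + 2 * t / h n * L (P (n + 1) * P n)
      = 2 * t / h (n + 1) * L (X * (P (n + 1) * P (n + 1))) := by
  have := (H.pos n).ne'
  have := (H.pos (n + 1)).ne'
  rw [← mul_assoc X, H.X_mul heven, add_mul, mul_assoc, ← smul_eq_C_mul, map_add, map_smul,
    smul_eq_mul, mul_comm (P n)]
  field_simp

lemma recurrence_coeff_mul_sub (H : IsMonicOrthogonal M P h) (hM : ∀ p, M p = L (X ^ 3 * p))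
    (heven : ∀ p, M (p.comp (-X)) = M p) (n : ℕ) :
    h (n + 2) / h (n + 1) * (2 * t / h (n + 2) * L (X * (P (n + 2) * P (n + 2))))
      - h (n + 1) / h n * (2 * t / h n * L (X * (P n * P n))) = 2 * t * (-1) ^ (n + 1) := by
  have h0 := (H.pos n).ne'
  have h1 := (H.pos (n + 1)).ne'
  have h2 := (H.pos (n + 2)).ne'
  have hN : ∀ p, (L ∘ₗ LinearMap.mulLeft ℝ (X ^ 2)) (X * p) = M p := fun p => by
    simp only [LinearMap.comp_apply, LinearMap.mulLeft_apply, hM]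
    congr 1
    ring
  have e0 := H.apply_consecutive heven hN n
  have e1 := H.apply_consecutive heven hN (n + 1)
  simp only [LinearMap.comp_apply, LinearMap.mulLeft_apply] at e0 e1
  set b := h (n + 1) / h n with hb
  have hXP := H.X_mul heven n
  have hpoly : X * (P (n + 2) * P (n + 2)) - C (b ^ 2) * (X * (P n * P n))
      = X ^ 2 * (P (n + 2) * P (n + 1)) - C b * (X ^ 2 * (P (n + 1) * P n)) := by
    rw [C_pow]
    linear_combination (-X * (P (n + 2) - C b * P n)) * hXP
  have hLpoly := congrArg L hpoly
  simp only [← smul_eq_C_mul, map_sub, map_smul, smul_eq_mul] at hLpoly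
  rw [e0, e1] at hLpoly
  have hmul : h (n + 1) = b * h n := by rw [hb]; field_simp
  rw [pow_succ (-1 : ℝ)] at hLpoly ⊢
  have hfin : (2 * t / h (n + 1)) * (L (X * (P (n + 2) * P (n + 2)))
      - b ^ 2 * L (X * (P n * P n))) = 2 * t * ((-1) ^ n * -1) := by
    rw [hLpoly, show b * ((1 + (-1) ^ n) / 2 * h n) = (1 + (-1) ^ n) / 2 * h (n + 1) by
      rw [hmul]; ring]
    field_simp
    ring
  rw [← hfin, hb]
  field_simp

end Ladder

/-- The telescoping identity behind the second compatibility condition. -/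
lemma sq_add_sum_eq_of_recurrences {t : ℝ} {β R r : ℕ → ℝ}
    (hr : ∀ n, r (n + 2) + r (n + 1) = R (n + 1)) (hr₁ : r 1 = R 0)
    (hβ : ∀ n : ℕ, 2 * β (n + 1) = n + 1 + r (n + 1))
    (hβR : ∀ n, β (n + 2) * R (n + 2) - β (n + 1) * R n = 2 * t * (-1) ^ (n + 1))
    (hβR₁ : β 1 * R 1 = 2 * t) (n : ℕ) :
    r (n + 1) ^ 2 + 2 * (1 - (-1 : ℝ) ^ (n + 1)) * t + ∑ j ∈ Finset.range (n + 1), R j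
      = 2 * β (n + 1) * R n + 2 * β (n + 1) * R (n + 1) := by
  induction n with
  | zero =>
    have := hβ 0
    simp only [Nat.cast_zero, zero_add, hr₁, Finset.sum_range_one] at this ⊢
    linear_combination (-R 0) * this - 2 * hβR₁
  | succ n ih =>
    rw [Finset.sum_range_succ]
    have e1 := hβ n
    have e2 := hβ (n + 1)
    push_cast at e2
    rw [pow_succ (-1 : ℝ) (n + 1)]
    linear_combination ih + (r (n + 2) - r (n + 1)) * hr n - R (n + 1) * (e2 - e1) - 2 * hβR n

theorem statement6
    (t : ℝ) (ht : 0 < t)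
    (P : ℕ → Polynomial ℝ)
    (hmonic : ∀ n, (P n).Monic)
    (hdeg : ∀ n, (P n).natDegree = n)
    (horth : ∀ m n : ℕ, m ≠ n → ∫ x : ℝ, (P m).eval x * (P n).eval x * w t x = 0)
    (h : ℕ → ℝ)
    (hh : ∀ n, h n = ∫ x : ℝ, ((P n).eval x) ^ 2 * w t x)
    (hhpos : ∀ n, 0 < h n)
    (R : ℕ → ℝ)
    (hR : ∀ n, R n = 2 * t / h n * ∫ y : ℝ, ((P n).eval y) ^ 2 / y ^ 2 * w t y)
    (r : ℕ → ℝ)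
    (hr : ∀ n, 1 ≤ n → r n = 2 * t / h (n - 1) *
      ∫ y : ℝ, (P n).eval y * (P (n - 1)).eval y / y ^ 3 * w t y)
    (β : ℕ → ℝ)
    (hβ : ∀ n, 1 ≤ n → β n = h n / h (n - 1))
    (n : ℕ) (hn : 1 ≤ n) :
    (r n) ^ 2 + 2 * (1 - (-1 : ℝ) ^ n) * t + ∑ j ∈ Finset.range n, R j
      = 2 * β n * R (n - 1) + 2 * β n * R n := by
  set L := cubeMoment ht with hL
  set M : ℝ[X] →ₗ[ℝ] ℝ := L ∘ₗ LinearMap.mulLeft ℝ (X ^ 3)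
  have hM : ∀ p, M p = L (X ^ 3 * p) := fun p => rfl
  have hMint : ∀ p, M p = ∫ x, p.eval x * w t x := cubeMoment_cube_mul ht
  have heven : ∀ p, M (p.comp (-X)) = M p := fun p => by
    have := cubeMoment_comp_neg_X ht (X ^ 3 * p)
    rw [mul_comp, pow_comp, X_comp, Odd.neg_pow (by decide), neg_mul, map_neg, neg_inj] at this
    exact this
  have H : IsMonicOrthogonal M P h :=
    ⟨hmonic, hdeg, fun m n hmn => by simpa only [hMint, eval_mul] using horth m n hmn,
      fun n => by simp only [hMint, eval_mul, hh, sq], hhpos⟩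
  have hR' : ∀ n, R n = 2 * t / h n * L (X * (P n * P n)) := fun n => by
    rw [hR, hL, cubeMoment_X_mul]
    simp only [eval_mul, sq]
  have hr' : ∀ n, r (n + 1) = 2 * t / h n * L (P (n + 1) * P n) := fun n => by
    rw [hr _ (by omega), hL, cubeMoment_apply]
    simp only [eval_mul, Nat.add_sub_cancel]
  have hβ' : ∀ n, β (n + 1) = h (n + 1) / h n := fun n => hβ _ (by omega)
  have hP₁ : P 1 = X * P 0 := by rw [H.one_eq_X heven, H.zero_eq_one, mul_one]
  obtain ⟨n, rfl⟩ := Nat.exists_eq_add_of_le' hn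
  refine sq_add_sum_eq_of_recurrences (fun n => ?_) ?_ (fun n => ?_) (fun n => ?_) ?_ n
  · rw [hr', hr', hR', apply_consecutive_add H heven]
  · rw [hr' 0, hR', zero_add, hP₁, mul_assoc]
  · rw [hβ', hr', two_mul_recurrence_coeff H hM (cubeMoment_derivative ht)]
  · rw [hβ', hβ', hR', hR', recurrence_coeff_mul_sub H hM heven]
  · have h₀ := (hhpos 0).ne'
    have h₁ := (hhpos 1).ne'
    rw [hβ' 0, hR', zero_add, hP₁, show X * (X * P 0 * (X * P 0)) = X ^ 3 * (P 0 * P 0) by ring,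
      ← hM, H.norm]
    field_simp
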